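/- arXiv:0704.0800 — 4 statements merged into one kernel-verified Lean document; each statement's English description precedes it below -/
import Mathlib

section
/- For all integers n ≥ 2, I ≥ 2 and p ≥ 1, with m = I + p, (2^m − 1)^n ≥ ((n + 1)^I − 1)·2^(n·p). -/
theorem two_pow_add_pow_add_succ_pow_le {A I : ℕ} (hA : 3 ≤ A) (hI : 2 ≤ I) :
    2 ^ I + A ^ I + (A + 1) ^ I ≤ 2 ^ I * A ^ I := by
  rw [← mul_pow]
  induction I, hI using Nat.le_induction with
  | base => nlinarith
  | succ k _ ih =>
    calc 2 ^ (k + 1) + A ^ (k + 1) + (A + 1) ^ (k + 1)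
        = 2 ^ k * 2 + A ^ k * A + (A + 1) ^ k * (A + 1) := by simp only [pow_succ]
      _ ≤ 2 ^ k * (2 * A) + A ^ k * (2 * A) + (A + 1) ^ k * (2 * A) := by
        gcongr <;> omega
      _ = (2 ^ k + A ^ k + (A + 1) ^ k) * (2 * A) := by ring
      _ ≤ (2 * A) ^ k * (2 * A) := by gcongr
      _ = (2 * A) ^ (k + 1) := (pow_succ _ _).symm

theorem two_mul_two_pow_add_three_pow_le {I : ℕ} (hI : 2 ≤ I) :
    2 * 2 ^ I + 3 ^ I ≤ 4 ^ I + 2 := by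
  induction I, hI using Nat.le_induction with
  | base => norm_num
  | succ k _ ih =>
    have h2 : 1 < 2 ^ k := Nat.one_lt_two_pow (by omega)
    simp only [pow_succ]
    omega

theorem succ_pow_le_two_pow_sub_one_pow_add_one {n I : ℕ} (hn : 2 ≤ n) (hI : 2 ≤ I) :
    (n + 1) ^ I ≤ (2 ^ I - 1) ^ n + 1 := by
  obtain ⟨x, hx⟩ : ∃ x, 2 ^ I = x + 1 :=
    Nat.exists_eq_succ_of_ne_zero (by positivity)
  rw [hx, Nat.add_sub_cancel]
  induction n, hn using Nat.le_induction with
  | base =>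
    have h := two_mul_two_pow_add_three_pow_le hI
    have h4 : (4 : ℕ) ^ I = (x + 1) ^ 2 := by
      rw [← hx, ← pow_mul, mul_comm, pow_mul]; norm_num
    rw [h4, hx] at h
    norm_num
    nlinarith
  | succ k hk ih =>
    have h := two_pow_add_pow_add_succ_pow_le (A := k + 1) (by omega) hI
    rw [hx] at h
    have := Nat.mul_le_mul_left x ih
    rw [pow_succ]
    nlinarith

/-- For `n ≥ 2`, `I ≥ 2`, `p ≥ 1` and `m = I + p`,
`(2^m - 1)^n ≥ ((n + 1)^I - 1) * 2^(n*p)`. -/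
theorem combinatorial_collusion_inequality (n I p m : ℕ)
    (hn : 2 ≤ n) (hI : 2 ≤ I) (hp : 1 ≤ p) (hm : m = I + p) :
    (2 ^ m - 1) ^ n ≥ ((n + 1) ^ I - 1) * 2 ^ (n * p) := by
  subst hm
  calc ((n + 1) ^ I - 1) * 2 ^ (n * p)
      ≤ (2 ^ I - 1) ^ n * 2 ^ (n * p) :=
        Nat.mul_le_mul_right _
          (Nat.sub_le_of_le_add (succ_pow_le_two_pow_sub_one_pow_add_one hn hI))
    _ = ((2 ^ I - 1) * 2 ^ p) ^ n := by rw [mul_pow, ← pow_mul, mul_comm n p]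
    _ ≤ (2 ^ (I + p) - 1) ^ n := by
      refine Nat.pow_le_pow_left ?_ n
      rw [Nat.sub_mul, one_mul, ← pow_add]
      exact Nat.sub_le_sub_left Nat.one_le_two_pow _
end

section
/- For all integers n ≥ 2 and I ≥ 2, (2^I − 1)^n ≥ (n + 1)^I − 1. -/
theorem pow_add_two_pow_add_succ_pow_le (a I : ℕ) (ha : 2 ≤ a) (hI : 2 ≤ I) :
    a ^ I + 2 ^ I + (a + 1) ^ I ≤ a ^ I * 2 ^ I + 2 := by
  induction I, hI using Nat.le_induction with
  | base => nlinarith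
  | succ k hk ih =>
    have h4 : 2 ^ 2 ≤ 2 ^ k := Nat.pow_le_pow_right (by norm_num) hk
    have h1 := Nat.mul_le_mul_left (2 * a) ih
    have h2 : (a + 1) * (a + 1) ^ k ≤ 2 * a * (a + 1) ^ k :=
      Nat.mul_le_mul_right _ (by omega)
    have h3 : a * a ^ k ≤ 2 * a * a ^ k := Nat.mul_le_mul_right _ (by omega)
    obtain ⟨b, rfl⟩ := Nat.exists_eq_add_of_le' ha
    simp only [pow_succ _ k]
    nlinarith [Nat.mul_le_mul_left b h4]

/-- For all integers `n ≥ 2` and `I ≥ 2`, `(2^I - 1)^n ≥ (n + 1)^I - 1`. -/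
theorem pow_two_pow_sub_one_ge (n I : ℕ) (hn : 2 ≤ n) (hI : 2 ≤ I) :
    (2 ^ I - 1) ^ n ≥ (n + 1) ^ I - 1 := by
  have hn' : 1 ≤ n := by omega
  clear hn
  induction n, hn' using Nat.le_induction with
  | base => simp
  | succ n hn ih =>
    have key := pow_add_two_pow_add_succ_pow_le (n + 1) I (by omega) hI
    have step := Nat.mul_le_mul_right (2 ^ I - 1) ih
    rw [← pow_succ] at step
    refine le_trans ?_ step
    obtain ⟨x, hx⟩ := Nat.exists_eq_add_of_le' (Nat.one_le_two_pow (n := I))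
    obtain ⟨y, hy⟩ := Nat.exists_eq_add_of_le' (Nat.one_le_pow I (n + 1) (by omega))
    rw [hx, hy] at key ⊢
    simp only [Nat.add_sub_cancel]
    rw [Nat.sub_le_iff_le_add]
    linarith
end

section
/- For all integers n ≥ 2 and m ≥ 2, (2^m − 1)^n ≥ (n + 1)^m; equivalently, (2^m − 1)^(1/m) ≥ (n + 1)^(1/n), with equality exactly when m = n = 2, where both sides equal √3. -/
theorem succ_sq_lt_three_pow {n : ℕ} (hn : 3 ≤ n) : (n + 1) ^ 2 < 3 ^ n := by
  induction n, hn using Nat.le_induction with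
  | base => norm_num
  | succ k hk ih => rw [pow_succ 3 k]; nlinarith

theorem succ_sq_le_three_pow {n : ℕ} (hn : 2 ≤ n) : (n + 1) ^ 2 ≤ 3 ^ n := by
  rcases hn.eq_or_lt with rfl | h
  · norm_num
  · exact (succ_sq_lt_three_pow h).le

theorem three_pow_add_two_mul_two_pow_lt {m : ℕ} (hm : 3 ≤ m) :
    3 ^ m + 2 * 2 ^ m < (2 ^ m) ^ 2 + 1 := by
  induction m, hm using Nat.le_induction with
  | base => norm_num
  | succ k hk ih =>
    rw [pow_succ 3 k, pow_succ 2 k]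
    nlinarith [Nat.one_le_two_pow (n := k)]

theorem three_pow_lt_two_pow_sub_one_sq {m : ℕ} (hm : 3 ≤ m) : 3 ^ m < (2 ^ m - 1) ^ 2 := by
  have h := three_pow_add_two_mul_two_pow_lt hm
  obtain ⟨x, hx⟩ := Nat.exists_eq_add_of_le' (Nat.one_le_two_pow (n := m))
  rw [hx] at h ⊢
  rw [Nat.add_sub_cancel]
  nlinarith

theorem three_pow_le_two_pow_sub_one_sq {m : ℕ} (hm : 2 ≤ m) : 3 ^ m ≤ (2 ^ m - 1) ^ 2 := by
  rcases hm.eq_or_lt with rfl | h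
  · norm_num
  · exact (three_pow_lt_two_pow_sub_one_sq h).le

theorem succ_pow_le_two_pow_sub_one_pow {n m : ℕ} (hn : 2 ≤ n) (hm : 2 ≤ m) :
    (n + 1) ^ m ≤ (2 ^ m - 1) ^ n := by
  rw [← Nat.pow_le_pow_iff_left two_ne_zero]
  calc ((n + 1) ^ m) ^ 2 = ((n + 1) ^ 2) ^ m := pow_right_comm ..
    _ ≤ (3 ^ n) ^ m := Nat.pow_le_pow_left (succ_sq_le_three_pow hn) m
    _ = (3 ^ m) ^ n := pow_right_comm ..
    _ ≤ ((2 ^ m - 1) ^ 2) ^ n := Nat.pow_le_pow_left (three_pow_le_two_pow_sub_one_sq hm) n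
    _ = ((2 ^ m - 1) ^ n) ^ 2 := pow_right_comm ..

theorem succ_pow_eq_two_pow_sub_one_pow_iff {n m : ℕ} (hn : 2 ≤ n) (hm : 2 ≤ m) :
    (2 ^ m - 1) ^ n = (n + 1) ^ m ↔ m = 2 ∧ n = 2 := by
  refine ⟨fun h => ?_, by rintro ⟨rfl, rfl⟩; norm_num⟩
  have h₁ : ((n + 1) ^ 2) ^ m ≤ (3 ^ n) ^ m := Nat.pow_le_pow_left (succ_sq_le_three_pow hn) m
  have h₂ : (3 ^ m) ^ n ≤ ((2 ^ m - 1) ^ 2) ^ n :=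
    Nat.pow_le_pow_left (three_pow_le_two_pow_sub_one_sq hm) n
  have h₃ : ((2 ^ m - 1) ^ 2) ^ n = ((n + 1) ^ 2) ^ m := by
    rw [pow_right_comm, h, pow_right_comm]
  have h₄ : (3 ^ n) ^ m = (3 ^ m) ^ n := pow_right_comm ..
  constructor
  · by_contra hne
    have := Nat.pow_lt_pow_left (three_pow_lt_two_pow_sub_one_sq (m := m) (by omega))
      (show n ≠ 0 by omega)
    omega
  · by_contra hne
    have := Nat.pow_lt_pow_left (succ_sq_lt_three_pow (n := n) (by omega))
      (show m ≠ 0 by omega)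
    omega

theorem rpow_one_div_le_rpow_one_div_iff {a b : ℝ} (ha : 0 ≤ a) (hb : 0 ≤ b) {m n : ℕ}
    (hm : m ≠ 0) (hn : n ≠ 0) :
    b ^ ((1 : ℝ) / n) ≤ a ^ ((1 : ℝ) / m) ↔ b ^ m ≤ a ^ n := by
  rw [← pow_le_pow_iff_left₀ (by positivity) (by positivity) (mul_ne_zero hm hn),
    pow_mul (a ^ _), mul_comm m n, pow_mul (b ^ _), one_div, one_div,
    Real.rpow_inv_natCast_pow ha hm, Real.rpow_inv_natCast_pow hb hn]

theorem rpow_one_div_eq_rpow_one_div_iff {a b : ℝ} (ha : 0 ≤ a) (hb : 0 ≤ b) {m n : ℕ}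
    (hm : m ≠ 0) (hn : n ≠ 0) :
    a ^ ((1 : ℝ) / m) = b ^ ((1 : ℝ) / n) ↔ a ^ n = b ^ m := by
  rw [le_antisymm_iff, le_antisymm_iff, rpow_one_div_le_rpow_one_div_iff ha hb hm hn,
    rpow_one_div_le_rpow_one_div_iff hb ha hn hm]


/-- For all integers `n ≥ 2` and `m ≥ 2`, `(2^m - 1)^n ≥ (n + 1)^m`; equivalently
`(2^m - 1)^(1/m) ≥ (n + 1)^(1/n)` (real powers), with equality exactly when
`m = n = 2`, where both sides equal `√3`. -/
theorem pow_sub_one_ge_succ_pow (n m : ℕ) (hn : 2 ≤ n) (hm : 2 ≤ m) :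
    (2 ^ m - 1) ^ n ≥ (n + 1) ^ m ∧
    ((2 : ℝ) ^ (m : ℝ) - 1) ^ ((1 : ℝ) / m) ≥ ((n : ℝ) + 1) ^ ((1 : ℝ) / n) ∧
    (((2 : ℝ) ^ (m : ℝ) - 1) ^ ((1 : ℝ) / m) = ((n : ℝ) + 1) ^ ((1 : ℝ) / n) ↔
      m = 2 ∧ n = 2) ∧
    (m = 2 ∧ n = 2 →
      ((2 : ℝ) ^ (m : ℝ) - 1) ^ ((1 : ℝ) / m) = Real.sqrt 3 ∧
      ((n : ℝ) + 1) ^ ((1 : ℝ) / n) = Real.sqrt 3) := by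
  have hm₀ : m ≠ 0 := by omega
  have hn₀ : n ≠ 0 := by omega
  have ha : (2 : ℝ) ^ (m : ℝ) - 1 = ((2 ^ m - 1 : ℕ) : ℝ) := by
    rw [Nat.cast_sub Nat.one_le_two_pow, Real.rpow_natCast]
    push_cast
    rfl
  have hb : (n : ℝ) + 1 = ((n + 1 : ℕ) : ℝ) := by push_cast; rfl
  have hle := succ_pow_le_two_pow_sub_one_pow hn hm
  refine ⟨hle, ?_, ?_, ?_⟩
  · rw [ha, hb, ge_iff_le,
      rpow_one_div_le_rpow_one_div_iff (Nat.cast_nonneg _) (Nat.cast_nonneg _) hm₀ hn₀]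
    exact_mod_cast hle
  · rw [ha, hb,
      rpow_one_div_eq_rpow_one_div_iff (Nat.cast_nonneg _) (Nat.cast_nonneg _) hm₀ hn₀,
      ← succ_pow_eq_two_pow_sub_one_pow_iff hn hm]
    norm_cast
  · rintro ⟨rfl, rfl⟩
    rw [Real.sqrt_eq_rpow]
    norm_num
end

section
/- The real function h(x) = (2^x − 1)^(1/x) is monotone nondecreasing on [2, ∞); that is, for all real numbers 2 ≤ a ≤ b, (2^a − 1)^(1/a) ≤ (2^b − 1)^(1/b). -/
/-- The real function `h(x) = (2^x - 1)^(1/x)` (real powers) is monotone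
nondecreasing on `[2, ∞)`. -/
theorem rpow_two_pow_sub_one_monotone :
    ∀ a b : ℝ, 2 ≤ a → a ≤ b →
      ((2 : ℝ) ^ a - 1) ^ (1 / a) ≤ ((2 : ℝ) ^ b - 1) ^ (1 / b) := by
  intro a b ha hab
  have ha0 : 0 < a := by linarith
  have hb0 : 0 < b := by linarith
  have hx : 0 ≤ (2 : ℝ) ^ a - 1 :=
    sub_nonneg.2 (Real.one_le_rpow one_le_two ha0.le)
  have key : ((2 : ℝ) ^ a - 1) ^ (b / a) + 1 ≤ (2 : ℝ) ^ b := by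
    have h := Real.add_rpow_le_rpow_add hx zero_le_one ((one_le_div ha0).2 hab)
    rwa [Real.one_rpow, sub_add_cancel, ← Real.rpow_mul zero_le_two,
      mul_div_cancel₀ b ha0.ne'] at h
  calc ((2 : ℝ) ^ a - 1) ^ (1 / a)
      = (((2 : ℝ) ^ a - 1) ^ (b / a)) ^ (1 / b) := by
        rw [← Real.rpow_mul hx]
        congr 1
        field_simp
    _ ≤ ((2 : ℝ) ^ b - 1) ^ (1 / b) :=
        Real.rpow_le_rpow (Real.rpow_nonneg hx _) (le_sub_iff_add_le.2 key)
          (one_div_nonneg.2 hb0.le)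
end
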